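/- The center of S equals the image of R in S; that is, an element of S is central if and only if it lies in R·1. -/

import Mathlib

set_option synthInstance.maxHeartbeats 1000000
set_option maxHeartbeats 2000000
noncomputable section
abbrev R : Type := MvPowerSeries (Fin 2) ℂ
abbrev u : R := MvPowerSeries.X 0
abbrev v : R := MvPowerSeries.X 1

/-- The defining relations of `S = R⟨x,y⟩/(x^e−u, y^e−v, yx−ζxy)`. -/
inductive Srel (e : ℕ) (ζ : ℂ) : FreeAlgebra R (Fin 2) → FreeAlgebra R (Fin 2) → Prop
  | xe : Srel e ζ (FreeAlgebra.ι R (0 : Fin 2) ^ e) (algebraMap R _ u)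
  | ye : Srel e ζ (FreeAlgebra.ι R (1 : Fin 2) ^ e) (algebraMap R _ v)
  | comm : Srel e ζ (FreeAlgebra.ι R (1 : Fin 2) * FreeAlgebra.ι R (0 : Fin 2))
      (algebraMap R _ (algebraMap ℂ R ζ) * (FreeAlgebra.ι R (0 : Fin 2) * FreeAlgebra.ι R (1 : Fin 2)))

/-- The `R`-algebra `S`. -/
abbrev Salg (e : ℕ) (ζ : ℂ) : Type := RingQuot (Srel e ζ)

/-- The generator `x ∈ S`. -/
def xS (e : ℕ) (ζ : ℂ) : Salg e ζ := RingQuot.mkAlgHom R (Srel e ζ) (FreeAlgebra.ι R 0)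

/-- The generator `y ∈ S`. -/
def yS (e : ℕ) (ζ : ℂ) : Salg e ζ := RingQuot.mkAlgHom R (Srel e ζ) (FreeAlgebra.ι R 1)


section Model

open scoped TensorProduct

variable {A : Type} [CommRing A]

/-- The algebra `A[T]/(T^e - a)`. -/
abbrev RootAlg (e : ℕ) (a : A) : Type := AdjoinRoot (Polynomial.X ^ e - Polynomial.C a)

lemma rootAlg_root_pow (e : ℕ) (a : A) :
    (AdjoinRoot.root (Polynomial.X ^ e - Polynomial.C a)) ^ e = algebraMap A (RootAlg e a) a := by
  have h := AdjoinRoot.eval₂_root (Polynomial.X ^ e - Polynomial.C a)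
  rw [Polynomial.eval₂_sub, Polynomial.eval₂_pow, Polynomial.eval₂_X, Polynomial.eval₂_C,
    sub_eq_zero] at h
  exact h

/-- The powers `1, T, …, T^(e-1)` form a basis of `A[T]/(T^e - a)`. -/
lemma exists_rootAlg_basis [Nontrivial A] (e : ℕ) (he : e ≠ 0) (a : A) :
    ∃ b : Module.Basis (Fin e) A (RootAlg e a), ∀ i, b i = AdjoinRoot.root _ ^ (i : ℕ) := by
  have hm : (Polynomial.X ^ e - Polynomial.C a).Monic := Polynomial.monic_X_pow_sub_C a he
  have hd : (AdjoinRoot.powerBasis' hm).dim = e := by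
    rw [AdjoinRoot.powerBasis'_dim, Polynomial.natDegree_X_pow_sub_C]
  refine ⟨(AdjoinRoot.powerBasis' hm).basis.reindex (finCongr hd), fun i => ?_⟩
  rw [Module.Basis.reindex_apply, PowerBasis.basis_eq_pow, AdjoinRoot.powerBasis'_gen]
  rfl

/-- The endomorphism `T ↦ z T` of `A[T]/(T^e - a)`, for `z ^ e = 1`. -/
def rootAlgTwist (e : ℕ) (a z : A) (hz : z ^ e = 1) : RootAlg e a →ₐ[A] RootAlg e a :=
  AdjoinRoot.liftAlgHom _ (Algebra.ofId A _) (z • AdjoinRoot.root _) (by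
    rw [Polynomial.eval₂_sub, Polynomial.eval₂_pow, Polynomial.eval₂_X, Polynomial.eval₂_C,
      smul_pow, hz, one_smul, rootAlg_root_pow]
    exact sub_self _)

lemma rootAlgTwist_root (e : ℕ) (a z : A) (hz : z ^ e = 1) :
    rootAlgTwist e a z hz (AdjoinRoot.root _) = z • AdjoinRoot.root _ :=
  AdjoinRoot.liftAlgHom_root ..

lemma rootAlgTwist_pow (e : ℕ) (a z : A) (hz : z ^ e = 1) :
    (rootAlgTwist e a z hz).toLinearMap ^ e = 1 := by
  have h : ∀ n : ℕ, ((rootAlgTwist e a z hz) ^ n) (AdjoinRoot.root _)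
      = z ^ n • AdjoinRoot.root _ := by
    intro n
    induction n with
    | zero => simp
    | succ n ih =>
      rw [pow_succ, AlgHom.mul_apply, rootAlgTwist_root, map_smul, ih, smul_smul, pow_succ']
  have h1 : (rootAlgTwist e a z hz) ^ e = 1 := by
    apply AdjoinRoot.algHom_ext
    rw [h, hz, one_smul, AlgHom.one_apply]
  have h2 : ∀ n : ℕ, ((rootAlgTwist e a z hz) ^ n).toLinearMap
      = (rootAlgTwist e a z hz).toLinearMap ^ n := by
    intro n
    induction n with
    | zero => rfl
    | succ n ih => rw [pow_succ, pow_succ, ← ih]; rfl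
  rw [← h2, h1]
  rfl

/-- The operator by which `x` acts on the model of `S`. -/
def modelX (e : ℕ) (a b : A) : Module.End A (RootAlg e a ⊗[A] RootAlg e b) :=
  TensorProduct.map (LinearMap.mulLeft A (AdjoinRoot.root _)) 1

/-- The operator by which `y` acts on the model of `S`. -/
def modelY (e : ℕ) (a b z : A) (hz : z ^ e = 1) : Module.End A (RootAlg e a ⊗[A] RootAlg e b) :=
  TensorProduct.map (rootAlgTwist e a z hz).toLinearMap (LinearMap.mulLeft A (AdjoinRoot.root _))

lemma modelX_pow (e : ℕ) (a b : A) : modelX e a b ^ e = algebraMap A _ a := by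
  rw [modelX, TensorProduct.map_pow, LinearMap.pow_mulLeft, rootAlg_root_pow, one_pow]
  apply TensorProduct.ext'
  intro p q
  simp [Module.algebraMap_end_apply, ← Algebra.smul_def, TensorProduct.smul_tmul', -AdjoinRoot.algebraMap_eq]

lemma modelY_pow (e : ℕ) (a b z : A) (hz : z ^ e = 1) :
    modelY e a b z hz ^ e = algebraMap A _ b := by
  rw [modelY, TensorProduct.map_pow, LinearMap.pow_mulLeft, rootAlg_root_pow, rootAlgTwist_pow]
  apply TensorProduct.ext'
  intro p q
  simp [Module.algebraMap_end_apply, ← Algebra.smul_def, -AdjoinRoot.algebraMap_eq]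

lemma modelY_mul_modelX (e : ℕ) (a b z : A) (hz : z ^ e = 1) :
    modelY e a b z hz * modelX e a b
      = algebraMap A _ z * (modelX e a b * modelY e a b z hz) := by
  apply TensorProduct.ext'
  intro p q
  simp [modelX, modelY, rootAlgTwist_root, TensorProduct.smul_tmul']

lemma modelX_pow_modelY_pow_one (e : ℕ) (a b z : A) (hz : z ^ e = 1) (i j : ℕ) :
    (modelX e a b ^ i * modelY e a b z hz ^ j) (1 ⊗ₜ 1)
      = (AdjoinRoot.root _ ^ i) ⊗ₜ (AdjoinRoot.root _ ^ j) := by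
  have h : ((rootAlgTwist e a z hz).toLinearMap ^ j) 1 = 1 := by
    induction j with
    | zero => rfl
    | succ n ih => rw [pow_succ, Module.End.mul_apply, AlgHom.toLinearMap_apply, map_one, ih]
  rw [Module.End.mul_apply, modelX, modelY, TensorProduct.map_pow, TensorProduct.map_pow,
    LinearMap.pow_mulLeft, LinearMap.pow_mulLeft, TensorProduct.map_tmul, h,
    TensorProduct.map_tmul]
  simp

end Model

lemma MvPowerSeries.X_ne_zero {σ A : Type*} [Semiring A] [Nontrivial A] (i : σ) :
    (MvPowerSeries.X i : MvPowerSeries σ A) ≠ 0 := by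
  intro h
  have h1 := congrArg (MvPowerSeries.coeff (Finsupp.single i 1)) h
  rw [MvPowerSeries.coeff_index_single_self_X, map_zero] at h1
  exact one_ne_zero h1

section Presentation

variable (e : ℕ) (ζ : ℂ)

lemma xS_pow : xS e ζ ^ e = algebraMap R (Salg e ζ) u := by
  rw [xS, ← map_pow, RingQuot.mkAlgHom_rel R Srel.xe, AlgHom.commutes]

lemma yS_pow : yS e ζ ^ e = algebraMap R (Salg e ζ) v := by
  rw [yS, ← map_pow, RingQuot.mkAlgHom_rel R Srel.ye, AlgHom.commutes]

lemma yS_mul_xS : yS e ζ * xS e ζ = (algebraMap ℂ R ζ) • (xS e ζ * yS e ζ) := by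
  rw [yS, xS, ← map_mul, RingQuot.mkAlgHom_rel R Srel.comm, map_mul, AlgHom.commutes, map_mul,
    Algebra.smul_def]

lemma yS_mul_xS_pow (i : ℕ) :
    yS e ζ * xS e ζ ^ i = (algebraMap ℂ R ζ) ^ i • (xS e ζ ^ i * yS e ζ) := by
  induction i with
  | zero => simp
  | succ n ih =>
    rw [pow_succ, ← mul_assoc, ih, smul_mul_assoc, mul_assoc, yS_mul_xS, mul_smul_comm, smul_smul,
      mul_assoc, pow_succ]

lemma yS_pow_mul_xS (j : ℕ) :
    yS e ζ ^ j * xS e ζ = (algebraMap ℂ R ζ) ^ j • (xS e ζ * yS e ζ ^ j) := by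
  induction j with
  | zero => simp
  | succ n ih =>
    rw [pow_succ', mul_assoc, ih, mul_smul_comm, ← mul_assoc, yS_mul_xS, smul_mul_assoc,
      smul_smul, mul_assoc, pow_succ]

/-- The monomials `x^i y^j` with `0 ≤ i, j < e`. -/
def monS (p : Fin e × Fin e) : Salg e ζ := xS e ζ ^ (p.1 : ℕ) * yS e ζ ^ (p.2 : ℕ)

variable {e ζ}

lemma xS_pow_mul_yS_pow_mem_span (he : 1 ≤ e) (m n : ℕ) :
    xS e ζ ^ m * yS e ζ ^ n ∈ Submodule.span R (Set.range (monS e ζ)) := by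
  have h : xS e ζ ^ m * yS e ζ ^ n = (u ^ (m / e) * v ^ (n / e)) •
      monS e ζ (⟨m % e, Nat.mod_lt _ he⟩, ⟨n % e, Nat.mod_lt _ he⟩) := by
    conv_lhs => rw [← Nat.div_add_mod m e, ← Nat.div_add_mod n e]
    rw [pow_add, pow_add, pow_mul, pow_mul, xS_pow, yS_pow, ← map_pow, ← map_pow,
      ← Algebra.smul_def, ← Algebra.smul_def, smul_mul_smul_comm, monS]
  rw [h]
  exact Submodule.smul_mem _ _ (Submodule.subset_span ⟨_, rfl⟩)

lemma span_monS (he : 1 ≤ e) : Submodule.span R (Set.range (monS e ζ)) = ⊤ := by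
  set P := Submodule.span R (Set.range (monS e ζ))
  have key : ∀ t : FreeAlgebra R (Fin 2), ∀ p ∈ P, RingQuot.mkAlgHom R (Srel e ζ) t * p ∈ P := by
    intro t
    induction t using FreeAlgebra.induction with
    | grade0 r =>
      intro p hp
      rw [AlgHom.commutes, ← Algebra.smul_def]
      exact P.smul_mem _ hp
    | grade1 i =>
      intro p hp
      induction hp using Submodule.span_induction with
      | mem q hq =>
        obtain ⟨q, rfl⟩ := hq
        fin_cases i
        · change xS e ζ * (xS e ζ ^ _ * yS e ζ ^ _) ∈ P
          rw [← mul_assoc, ← pow_succ']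
          exact xS_pow_mul_yS_pow_mem_span he _ _
        · change yS e ζ * (xS e ζ ^ _ * yS e ζ ^ _) ∈ P
          rw [← mul_assoc, yS_mul_xS_pow, smul_mul_assoc, mul_assoc, ← pow_succ']
          exact P.smul_mem _ (xS_pow_mul_yS_pow_mem_span he _ _)
      | zero => rw [mul_zero]; exact P.zero_mem
      | add a b _ _ ha hb => rw [mul_add]; exact P.add_mem ha hb
      | smul r a _ ha => rw [mul_smul_comm]; exact P.smul_mem _ ha
    | mul a b ha hb =>
      intro p hp
      rw [map_mul, mul_assoc]
      exact ha _ (hb _ hp)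
    | add a b ha hb =>
      intro p hp
      rw [map_add, add_mul]
      exact P.add_mem (ha _ hp) (hb _ hp)
  rw [eq_top_iff]
  intro s _
  obtain ⟨t, rfl⟩ := RingQuot.mkAlgHom_surjective R (Srel e ζ) s
  have h1 : (1 : Salg e ζ) ∈ P := by
    simpa using xS_pow_mul_yS_pow_mem_span (ζ := ζ) he 0 0
  simpa using key t 1 h1

/-- The action of `S` on its model. -/
def modelRep (hz : (algebraMap ℂ R ζ) ^ e = 1) :
    Salg e ζ →ₐ[R] Module.End R (TensorProduct R (RootAlg e u) (RootAlg e v)) :=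
  RingQuot.liftAlgHom R ⟨FreeAlgebra.lift R ![modelX e u v, modelY e u v _ hz], by
    intro p q h
    cases h with
    | xe => simp [modelX_pow]
    | ye => simp [modelY_pow]
    | comm => simp only [map_mul, AlgHom.commutes, FreeAlgebra.lift_ι_apply]
              exact modelY_mul_modelX ..⟩

lemma modelRep_xS (hz : (algebraMap ℂ R ζ) ^ e = 1) : modelRep hz (xS e ζ) = modelX e u v := by
  simp [modelRep, xS]

lemma modelRep_yS (hz : (algebraMap ℂ R ζ) ^ e = 1) :
    modelRep hz (yS e ζ) = modelY e u v _ hz := by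
  simp [modelRep, yS]

lemma linearIndependent_monS (he : 1 ≤ e) (hζ : ζ ^ e = 1) :
    LinearIndependent R (monS e ζ) := by
  have hz : (algebraMap ℂ R ζ) ^ e = 1 := by rw [← map_pow, hζ, map_one]
  obtain ⟨b, hb⟩ := exists_rootAlg_basis e (by omega) u
  obtain ⟨c, hc⟩ := exists_rootAlg_basis e (by omega) v
  apply LinearIndependent.of_comp
    ((LinearMap.applyₗ (TensorProduct.tmul R 1 1)).comp (modelRep hz).toLinearMap)
  have h : (LinearMap.applyₗ (TensorProduct.tmul R 1 1)).comp (modelRep hz).toLinearMap ∘ monS e ζ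
      = b.tensorProduct c := by
    funext p
    rw [Module.Basis.tensorProduct_apply, hb, hc, ← modelX_pow_modelY_pow_one e u v _ hz,
      ← modelRep_xS hz, ← modelRep_yS hz, ← map_pow, ← map_pow, ← map_mul]
    rfl
  rw [h]
  exact (b.tensorProduct c).linearIndependent

lemma eq_of_smul_sum_monS_eq (he : 1 ≤ e) (hζ : ζ ^ e = 1) {r : R} (hr : r ≠ 0)
    {a b : Fin e × Fin e → R} (h : r • ∑ p, a p • monS e ζ p = r • ∑ p, b p • monS e ζ p)
    (p : Fin e × Fin e) : a p = b p := by
  rw [Finset.smul_sum, Finset.smul_sum] at h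
  simp_rw [smul_smul] at h
  have h0 : r * a p = r * b p := Fintype.linearIndependent_iffₛ.mp
    (linearIndependent_monS he hζ) (fun p => r * a p) (fun p => r * b p) h p
  exact mul_left_cancel₀ hr h0

lemma eq_zero_of_eq_mul_pow (hζ : IsPrimitiveRoot ζ e) {i : ℕ} (hi : i < e) (h0 : i ≠ 0) {r : R}
    (h : r = r * (algebraMap ℂ R ζ) ^ i) : r = 0 := by
  by_contra hr
  have h1 := mul_left_cancel₀ hr ((mul_one r).trans h)
  rw [← map_pow, ← map_one (algebraMap ℂ R)] at h1
  exact hζ.pow_ne_one_of_pos_of_lt h0 hi (FaithfulSMul.algebraMap_injective ℂ R h1.symm)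

end Presentation

/-!
STATEMENT 12: The center of `S` equals the image of `R` in `S`: an element of `S` is
central if and only if it lies in `R·1`.
-/

theorem center_of_Salg (e : ℕ) (he : 1 ≤ e) (ζ : ℂ) (hζ : IsPrimitiveRoot ζ e) :
    ∀ s : Salg e ζ, s ∈ Set.center (Salg e ζ) ↔ s ∈ Set.range (algebraMap R (Salg e ζ)) := by
  intro s
  constructor
  · intro hs
    rw [Semigroup.mem_center_iff] at hs
    have hmem : s ∈ Submodule.span R (Set.range (monS e ζ)) := by
      rw [span_monS he]; trivial
    obtain ⟨a, rfl⟩ := (Submodule.mem_span_range_iff_exists_fun R).mp hmem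
    have hx : u • ∑ p, a p • monS e ζ p
        = u • ∑ p, (a p * (algebraMap ℂ R ζ) ^ (p.2 : ℕ)) • monS e ζ p := by
      have h : xS e ζ * ∑ p, a p • monS e ζ p
          = xS e ζ * ∑ p, (a p * (algebraMap ℂ R ζ) ^ (p.2 : ℕ)) • monS e ζ p := by
        rw [hs (xS e ζ), Finset.mul_sum, Finset.sum_mul]
        refine Finset.sum_congr rfl fun p _ => ?_
        rw [monS, mul_smul_comm, smul_mul_assoc, mul_assoc, yS_pow_mul_xS,
          mul_smul_comm, ← mul_assoc, ← mul_assoc, ← pow_succ, ← pow_succ', smul_smul]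
      rw [Algebra.smul_def, Algebra.smul_def, ← xS_pow, ← pow_sub_mul_pow _ he, pow_one, mul_assoc,
        h, mul_assoc]
    have hy : v • ∑ p, a p • monS e ζ p
        = v • ∑ p, (a p * (algebraMap ℂ R ζ) ^ (p.1 : ℕ)) • monS e ζ p := by
      have h : (∑ p, a p • monS e ζ p) * yS e ζ
          = (∑ p, (a p * (algebraMap ℂ R ζ) ^ (p.1 : ℕ)) • monS e ζ p) * yS e ζ := by
        rw [← hs (yS e ζ), Finset.mul_sum, Finset.sum_mul]
        refine Finset.sum_congr rfl fun p _ => ?_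
        rw [monS, mul_smul_comm, smul_mul_assoc, ← mul_assoc, yS_mul_xS_pow,
          smul_mul_assoc, mul_assoc, mul_assoc, ← pow_succ, ← pow_succ', smul_smul]
      rw [Algebra.smul_def, Algebra.smul_def, Algebra.commutes, Algebra.commutes, ← yS_pow,
        ← pow_mul_pow_sub _ he, pow_one, ← mul_assoc, h, mul_assoc]
    have ha : ∀ p : Fin e × Fin e, p ≠ (⟨0, he⟩, ⟨0, he⟩) → a p = 0 := by
      rintro ⟨i, j⟩ hp
      by_cases hj : (j : ℕ) = 0
      · have hi : (i : ℕ) ≠ 0 := fun hi => hp (Prod.ext (Fin.ext hi) (Fin.ext hj))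
        exact eq_zero_of_eq_mul_pow hζ i.2 hi
          (eq_of_smul_sum_monS_eq he hζ.pow_eq_one (MvPowerSeries.X_ne_zero 1) hy (i, j))
      · exact eq_zero_of_eq_mul_pow hζ j.2 hj
          (eq_of_smul_sum_monS_eq he hζ.pow_eq_one (MvPowerSeries.X_ne_zero 0) hx (i, j))
    refine ⟨a (⟨0, he⟩, ⟨0, he⟩), ?_⟩
    rw [Finset.sum_eq_single (⟨0, he⟩, ⟨0, he⟩) (fun p _ hp => by rw [ha p hp, zero_smul])
      (fun h => absurd (Finset.mem_univ _) h), monS, Algebra.algebraMap_eq_smul_one]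
    simp
  · rintro ⟨r, rfl⟩
    rw [Semigroup.mem_center_iff]
    exact fun t => (Algebra.commutes r t).symm

end
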